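/- Let Y_κ and Y be centered Gaussian vectors in ℝ^p, p ≥ 2, whose covariance matrices satisfy Δ := max_{j,l≤p} |Cov(Y_{κ,j}, Y_{κ,l}) − Cov(Y_j, Y_l)| and min_{j≤p} E Y_j² ≥ b for a constant b > 0. Then there is a constant C depending only on b such that sup_{t∈ℝ} |P(|Y_κ|_∞ ≤ t) − P(|Y|_∞ ≤ t)| ≤ C Δ^{1/3} (1 ∨ log(p/Δ))^{2/3}. -/

import Mathlib

open MeasureTheory ProbabilityTheory

/-- A random vector `Y` in `ℝ^p` is a centered Gaussian vector with covariance matrix `S`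
if every linear functional `⟨a, Y⟩` has the normal law `N(0, aᵀ S a)`. -/
def IsCenteredGaussian {Ω : Type*} [MeasurableSpace Ω] (P : Measure Ω) {p : ℕ}
    (Y : Ω → Fin p → ℝ) (S : Matrix (Fin p) (Fin p) ℝ) : Prop :=
  Measurable Y ∧ ∀ a : Fin p → ℝ,
    Measure.map (fun ω => ∑ j, a j * Y ω j) P
      = gaussianReal 0 (∑ j, ∑ l, a j * S j l * a l).toNNReal

/-- The characteristic function of a scaled centered Gaussian measure. -/
theorem charFunDual_map_smul_of_centered {E : Type*} [NormedAddCommGroup E] [NormedSpace ℝ E]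
    [MeasurableSpace E] [BorelSpace E] [CompleteSpace E] [SecondCountableTopology E]
    {μ : Measure E} [IsGaussian μ] (hμ : μ[id] = 0) (c : ℝ) (L : StrongDual ℝ E) :
    charFunDual (μ.map (fun x => c • x)) L = Complex.exp (-(c ^ 2 * Var[L; μ] : ℝ) / 2) := by
  have h := charFunDual_map (μ := μ) (c • ContinuousLinearMap.id ℝ E) L
  have h2 : L.comp (c • ContinuousLinearMap.id ℝ E) = c • L := by
    ext x; simp
  have h3 : ⇑(c • ContinuousLinearMap.id ℝ E) = fun x => c • x := by
    ext x; simp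
  rw [h2, h3] at h
  rw [h, IsGaussian.charFunDual_eq_of_integral_eq_zero hμ]
  have : Var[⇑(c • L); μ] = c ^ 2 * Var[L; μ] := by
    rw [FunLike.coe_smul, variance_smul]
  rw [this]

theorem map_smul_conv_congr {E : Type*} [NormedAddCommGroup E] [NormedSpace ℝ E]
    [MeasurableSpace E] [BorelSpace E] [CompleteSpace E] [SecondCountableTopology E]
    {μ ν : Measure E} [IsGaussian μ] [IsGaussian ν] (hμ : μ[id] = 0) (hν : ν[id] = 0)
    {a b c a' b' : ℝ} (h1 : a ^ 2 + c ^ 2 = a' ^ 2) (h2 : b ^ 2 = b' ^ 2) :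
    (μ.map (fun x => a • x) ∗ ν.map (fun x => b • x)) ∗ μ.map (fun x => c • x)
      = μ.map (fun x => a' • x) ∗ ν.map (fun x => b' • x) := by
  have I (ρ : Measure E) [IsGaussian ρ] (c : ℝ) : IsProbabilityMeasure (ρ.map (fun x => c • x)) :=
    Measure.isProbabilityMeasure_map (by fun_prop)
  apply Measure.ext_of_charFunDual
  ext L
  simp only [charFunDual_conv, charFunDual_map_smul_of_centered hμ,
    charFunDual_map_smul_of_centered hν, ← Complex.exp_add]
  rw [← h1, ← h2]
  congr 1
  push_cast
  ring

/-- A small Gaussian increment is exchanged for another one in the expectation of a function with a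
second order Taylor expansion. -/
theorem abs_integral_exchange_le {ι : Type*} [Fintype ι] {μ ν : Measure (ι → ℝ)}
    [IsGaussian μ] [IsGaussian ν] (hμ : μ[id] = 0) (hν : ν[id] = 0)
    {f : (ι → ℝ) → ℝ} (hf : Continuous f) {B : ℝ} (hB : ∀ x, |f x| ≤ B)
    {g : ι → ℝ} {H : ι → ι → ℝ} {K M Δ : ℝ} (w : ι → ℝ)
    (hT : ∀ v, |f (w + v) - (f w + ∑ i, g i * v i + 1 / 2 * ∑ i, ∑ j, H i j * (v i * v j))|
      ≤ K * ‖v‖ ^ 3)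
    (hM : ∑ i, ∑ j, |H i j| ≤ M) (hΔ0 : 0 ≤ Δ)
    (hΔ : ∀ i j, |∫ x, x i * x j ∂μ - ∫ x, x i * x j ∂ν| ≤ Δ) {h : ℝ} (h0 : 0 ≤ h) :
    |∫ v, f (w + h • v) ∂μ - ∫ v, f (w + h • v) ∂ν|
      ≤ h ^ 2 * (1 / 2 * Δ * M) + h ^ 3 * (K * (∫ v, ‖v‖ ^ 3 ∂μ + ∫ v, ‖v‖ ^ 3 ∂ν)) := by
  set T : (ι → ℝ) → ℝ := fun v =>
    f w + h * ∑ i, g i * v i + h ^ 2 * (1 / 2 * ∑ i, ∑ j, H i j * (v i * v j)) with hTdef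
  have key (ρ : Measure (ι → ℝ)) [IsGaussian ρ] (hρ : ρ[id] = 0) :
      |∫ v, f (w + h • v) ∂ρ -
        (f w + h ^ 2 * (1 / 2 * ∑ i, ∑ j, H i j * ∫ x, x i * x j ∂ρ))|
        ≤ h ^ 3 * (K * ∫ v, ‖v‖ ^ 3 ∂ρ) := by
    have i3 : Integrable (fun v : ι → ℝ => ‖v‖ ^ 3) ρ := by
      have := (IsGaussian.memLp_id ρ 3 (by norm_num)).integrable_norm_pow (by norm_num)
      simpa using this
    have i1 (i : ι) : Integrable (fun v : ι → ℝ => v i) ρ := by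
      exact IsGaussian.integrable_dual ρ (ContinuousLinearMap.proj (R := ℝ) (φ := fun _ : ι => ℝ) i)
    have e1 (i : ι) : ∫ v : ι → ℝ, v i ∂ρ = 0 := by
      have := IsGaussian.integral_dual (μ := ρ) (ContinuousLinearMap.proj (R := ℝ) i)
      simp only [id_eq] at hρ
      simpa [hρ] using this
    have l2 (i : ι) : MemLp (fun v : ι → ℝ => v i) 2 ρ := by
      exact IsGaussian.memLp_dual ρ (ContinuousLinearMap.proj (R := ℝ) (φ := fun _ : ι => ℝ) i) 2
        (by norm_num)
    have i2 (i j : ι) : Integrable (fun v : ι → ℝ => v i * v j) ρ := (l2 i).integrable_mul (l2 j)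
    have if' : Integrable (fun v => f (w + h • v)) ρ := by
      refine Integrable.of_bound (C := B) ?_ (.of_forall fun v => ?_)
      · exact (hf.comp (by fun_prop)).aestronglyMeasurable
      · exact hB _
    have iT1 : Integrable (fun v : ι → ℝ => ∑ i, g i * v i) ρ :=
      integrable_finsetSum _ fun i _ => (i1 i).const_mul _
    have iT2 : Integrable (fun v : ι → ℝ => ∑ i, ∑ j, H i j * (v i * v j)) ρ :=
      integrable_finsetSum _ fun i _ => integrable_finsetSum _ fun j _ => (i2 i j).const_mul _
    have iT0 : Integrable (fun v : ι → ℝ => f w + h * ∑ i, g i * v i) ρ :=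
      (integrable_const _).add (iT1.const_mul _)
    have iT : Integrable T ρ := iT0.add ((iT2.const_mul _).const_mul _)
    have eT : ∫ v, T v ∂ρ = f w + h ^ 2 * (1 / 2 * ∑ i, ∑ j, H i j * ∫ x, x i * x j ∂ρ) := by
      rw [hTdef, integral_add iT0 ((iT2.const_mul _).const_mul _),
        integral_add (integrable_const _) (iT1.const_mul _)]
      have q (i : ι) : ∫ v : ι → ℝ, ∑ j, H i j * (v i * v j) ∂ρ
          = ∑ j, H i j * ∫ v : ι → ℝ, v i * v j ∂ρ := by
        rw [integral_finsetSum _ fun j _ => (i2 i j).const_mul _]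
        simp_rw [integral_const_mul]
      rw [integral_const_mul, integral_const_mul, integral_const_mul,
        integral_finsetSum _ fun i _ => (i1 i).const_mul _,
        integral_finsetSum _ fun i _ => integrable_finsetSum _ fun j _ => (i2 i j).const_mul _]
      simp_rw [integral_const_mul, e1, q]
      simp
    rw [← eT, ← integral_sub if' iT]
    calc |∫ v, (f (w + h • v) - T v) ∂ρ| ≤ ∫ v, h ^ 3 * (K * ‖v‖ ^ 3) ∂ρ := by
          rw [← Real.norm_eq_abs]
          refine norm_integral_le_of_norm_le ((i3.const_mul _).const_mul _) (.of_forall fun v => ?_)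
          have := hT (h • v)
          rw [norm_smul, Real.norm_of_nonneg h0] at this
          rw [Real.norm_eq_abs]
          convert this using 1
          · have q1 : ∑ i, g i * (h * v i) = h * ∑ i, g i * v i := by
              rw [Finset.mul_sum]
              exact Finset.sum_congr rfl fun i _ => by ring
            have q2 : ∑ i, ∑ j, H i j * (h * v i * (h * v j))
                = h ^ 2 * ∑ i, ∑ j, H i j * (v i * v j) := by
              simp_rw [Finset.mul_sum]
              exact Finset.sum_congr rfl fun i _ => Finset.sum_congr rfl fun j _ => by ring
            simp only [hTdef, Pi.smul_apply, smul_eq_mul, q1, q2]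
            congr 1
            ring
          · ring
      _ = _ := by rw [integral_const_mul, integral_const_mul]
  have k1 := abs_le.1 (key μ hμ)
  have k2 := abs_le.1 (key ν hν)
  have k3 : |∑ i, ∑ j, H i j * ∫ x, x i * x j ∂μ - ∑ i, ∑ j, H i j * ∫ x, x i * x j ∂ν|
      ≤ Δ * M := by
    simp_rw [← Finset.sum_sub_distrib, ← mul_sub]
    calc _ ≤ ∑ i, ∑ j, |H i j| * Δ := by
          refine (Finset.abs_sum_le_sum_abs _ _).trans (Finset.sum_le_sum fun i _ =>
            (Finset.abs_sum_le_sum_abs _ _).trans (Finset.sum_le_sum fun j _ => ?_))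
          rw [abs_mul]
          exact mul_le_mul_of_nonneg_left (hΔ i j) (abs_nonneg _)
      _ ≤ _ := by
          simp_rw [← Finset.sum_mul]
          rw [mul_comm]
          exact mul_le_mul_of_nonneg_left hM hΔ0
  have k4 := abs_le.1 k3
  have h2 : 0 ≤ h ^ 2 / 2 := by positivity
  have k5 := mul_le_mul_of_nonneg_left k4.1 h2
  have k6 := mul_le_mul_of_nonneg_left k4.2 h2
  rw [abs_le]
  constructor <;> linarith [k1.1, k1.2, k2.1, k2.2]

theorem abs_integral_sub_le_of_taylor {ι : Type*} [Fintype ι] {μ ν : Measure (ι → ℝ)}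
    [IsGaussian μ] [IsGaussian ν] (hμ : μ[id] = 0) (hν : ν[id] = 0)
    {f : (ι → ℝ) → ℝ} (hf : Continuous f) {B : ℝ} (hB : ∀ x, |f x| ≤ B)
    {g : (ι → ℝ) → ι → ℝ} {H : (ι → ℝ) → ι → ι → ℝ} {K M Δ : ℝ}
    (hT : ∀ w v, |f (w + v) - (f w + ∑ i, g w i * v i
      + 1 / 2 * ∑ i, ∑ j, H w i j * (v i * v j))| ≤ K * ‖v‖ ^ 3)
    (hM : ∀ w, ∑ i, ∑ j, |H w i j| ≤ M) (hΔ0 : 0 ≤ Δ)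
    (hΔ : ∀ i j, |∫ x, x i * x j ∂μ - ∫ x, x i * x j ∂ν| ≤ Δ) :
    |∫ x, f x ∂μ - ∫ x, f x ∂ν| ≤ 1 / 2 * Δ * M := by
  have I (ρ : Measure (ι → ℝ)) [IsGaussian ρ] (c : ℝ) :
      IsProbabilityMeasure (ρ.map (fun x => c • x)) :=
    Measure.isProbabilityMeasure_map (by fun_prop)
  set R := K * (∫ v, ‖v‖ ^ 3 ∂μ + ∫ v, ‖v‖ ^ 3 ∂ν) with hR
  have main (n : ℕ) (hn : 0 < n) :
      |∫ x, f x ∂μ - ∫ x, f x ∂ν| ≤ 1 / 2 * Δ * M + R * √(1 / n) := by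
    have hn' : (0 : ℝ) < n := by exact_mod_cast hn
    set h : ℝ := √(1 / n) with hh
    have h0 : 0 ≤ h := Real.sqrt_nonneg _
    have hsq : h ^ 2 = 1 / n := Real.sq_sqrt (by positivity)
    set T : ℕ → Measure (ι → ℝ) := fun k =>
      μ.map (fun x => √(k / n) • x) ∗ ν.map (fun x => √((n - k) / n) • x) with hTd
    have step (k : ℕ) (hk : k < n) :
        |∫ x, f x ∂T (k + 1) - ∫ x, f x ∂T k| ≤ 1 / n * (1 / 2 * Δ * M) + h * (1 / n) * R := by
      have hk' : (k : ℝ) + 1 ≤ n := by exact_mod_cast hk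
      set W := μ.map (fun x => √(k / n) • x) ∗ ν.map (fun x => √((n - (k + 1)) / n) • x) with hW
      have e1 : T (k + 1) = W ∗ μ.map (fun x => h • x) := by
        rw [hW, map_smul_conv_congr hμ hν (a' := √((k + 1) / n)) (b' := √((n - (k + 1)) / n)) _ rfl]
        · simp only [hTd, Nat.cast_add, Nat.cast_one]
        · rw [hsq, Real.sq_sqrt (by positivity), Real.sq_sqrt (by positivity)]; ring
      have e2 : T k = W ∗ ν.map (fun x => h • x) := by
        rw [hW, Measure.conv_comm (μ.map _), map_smul_conv_congr hν hμ
          (a' := √((n - k) / n)) (b' := √(k / n)) _ rfl, Measure.conv_comm]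
        rw [hsq, Real.sq_sqrt (div_nonneg (by linarith) hn'.le),
          Real.sq_sqrt (div_nonneg (by linarith) hn'.le)]; ring
      have ib (ρ : Measure (ι → ℝ)) [IsProbabilityMeasure ρ] : Integrable f ρ :=
        Integrable.of_bound hf.aestronglyMeasurable B (.of_forall hB)
      have ec (ρ : Measure (ι → ℝ)) [IsGaussian ρ] :
          ∫ x, f x ∂(W ∗ ρ.map (fun x => h • x)) = ∫ w, ∫ v, f (w + h • v) ∂ρ ∂W := by
        rw [integral_conv (ib _)]
        congr 1; ext w
        rw [integral_map (by fun_prop) (by fun_prop)]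
      have ii (ρ : Measure (ι → ℝ)) [IsGaussian ρ] :
          Integrable (fun w => ∫ v, f (w + h • v) ∂ρ) W := by
        have : Continuous fun w => ∫ v, f (w + h • v) ∂ρ := by
          refine continuous_of_dominated (bound := fun _ => B) ?_ ?_ (integrable_const _) ?_
          · intro w; exact (hf.comp (by fun_prop)).aestronglyMeasurable
          · intro w; exact .of_forall fun v => hB _
          · exact .of_forall fun v => hf.comp (by fun_prop)
        refine Integrable.of_bound this.aestronglyMeasurable B (.of_forall fun w => ?_)
        have := norm_integral_le_of_norm_le_const (μ := ρ) (f := fun v => f (w + h • v)) (C := B)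
          (.of_forall fun v => hB _)
        simpa using this
      rw [e1, e2, ec μ, ec ν, ← integral_sub (ii μ) (ii ν)]
      have := norm_integral_le_of_norm_le_const (μ := W)
        (f := fun w => ∫ v, f (w + h • v) ∂μ - ∫ v, f (w + h • v) ∂ν)
        (C := 1 / n * (1 / 2 * Δ * M) + h * (1 / n) * R) (.of_forall fun w => by
          have := abs_integral_exchange_le hμ hν hf hB w (hT w) (hM w) hΔ0 hΔ h0
          rw [pow_succ h 2, hsq, ← hR, mul_comm (1 / (n : ℝ)) h] at this
          simpa using this)
      simpa using this
    have hend : ∫ x, f x ∂T n = ∫ x, f x ∂μ := by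
      congr 1
      simp [hTd, hn'.ne', Measure.map_const]
    have hstart : ∫ x, f x ∂T 0 = ∫ x, f x ∂ν := by
      congr 1
      simp [hTd, hn'.ne', Measure.map_const]
    have tele := Finset.sum_range_sub (fun k => ∫ x, f x ∂T k) n
    rw [hend, hstart] at tele
    rw [← tele]
    calc _ ≤ ∑ k ∈ Finset.range n, (1 / n * (1 / 2 * Δ * M) + h * (1 / n) * R) :=
          (Finset.abs_sum_le_sum_abs _ _).trans
            (Finset.sum_le_sum fun k hk => step k (Finset.mem_range.1 hk))
      _ = _ := by
          rw [Finset.sum_const, Finset.card_range, nsmul_eq_mul]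
          field_simp
  have lim : Filter.Tendsto (fun n : ℕ => 1 / 2 * Δ * M + R * √(1 / (n : ℝ))) Filter.atTop
      (nhds (1 / 2 * Δ * M + R * √0)) :=
    ((tendsto_one_div_atTop_nhds_zero_nat.sqrt).const_mul R).const_add _
  have := ge_of_tendsto lim (Filter.eventually_atTop.2 ⟨1, fun n hn => main n hn⟩)
  simpa using this

theorem abs_sub_taylor_two_le {φ φ1 φ2 φ3 : ℝ → ℝ} (h0 : ∀ s, HasDerivAt φ (φ1 s) s)
    (h1 : ∀ s, HasDerivAt φ1 (φ2 s) s) (h2 : ∀ s, HasDerivAt φ2 (φ3 s) s) {K : ℝ}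
    (h3 : ∀ s, |φ3 s| ≤ K) :
    |φ 1 - (φ 0 + φ1 0 + 1 / 2 * φ2 0)| ≤ K := by
  have hK : 0 ≤ K := (abs_nonneg _).trans (h3 0)
  have mv {F F' : ℝ → ℝ} (hF : ∀ s, HasDerivAt F (F' s) s)
      (hb : ∀ s ∈ Set.Icc (0 : ℝ) 1, |F' s| ≤ K) (h : F 0 = 0) :
      ∀ s ∈ Set.Icc (0 : ℝ) 1, |F s| ≤ K := by
    intro s hs
    have := norm_image_sub_le_of_norm_deriv_le_segment' (f := F) (f' := F') (a := 0) (b := 1)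
      (C := K) (fun x _ => (hF x).hasDerivWithinAt)
      (fun x hx => hb x ⟨hx.1, hx.2.le⟩) s hs
    rw [h, sub_zero, sub_zero, Real.norm_eq_abs] at this
    exact this.trans (mul_le_of_le_one_right hK hs.2)
  have s1 := mv (F := fun s => φ2 s - φ2 0) (F' := φ3) (fun s => (h2 s).sub_const _)
    (fun s _ => h3 s) (by simp)
  have s2 := mv (F := fun s => φ1 s - φ1 0 - s * φ2 0) (F' := fun s => φ2 s - φ2 0)
    (fun s => by simpa using ((h1 s).sub_const (φ1 0)).fun_sub ((hasDerivAt_id s).mul_const (φ2 0)))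
    s1 (by simp)
  have s3 := mv (F := fun s => φ s - φ 0 - s * φ1 0 - s ^ 2 / 2 * φ2 0)
    (F' := fun s => φ1 s - φ1 0 - s * φ2 0)
    (fun s => by
      have q : HasDerivAt (fun s : ℝ => s ^ 2 / 2) s s := by
        refine HasDerivAt.congr_deriv (((hasDerivAt_id s).fun_pow 2).div_const 2) ?_
        simp
      have := (((h0 s).sub_const (φ 0)).fun_sub ((hasDerivAt_id s).mul_const (φ1 0))).fun_sub
        (q.mul_const (φ2 0))
      simpa using this)
    s2 (by simp)
  have := s3 1 (by simp)
  convert this using 2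
  ring

/-- The Gibbs weights of the softmax at inverse temperature `β`. -/
noncomputable def gibbsWeight {ι : Type*} [Fintype ι] (β : ℝ) (w : ι → ℝ) (i : ι) : ℝ :=
  Real.exp (β * w i) / ∑ j, Real.exp (β * w j)

theorem gibbsWeight_nonneg {ι : Type*} [Fintype ι] (β : ℝ) (w : ι → ℝ) (i : ι) :
    0 ≤ gibbsWeight β w i := by
  unfold gibbsWeight; positivity

theorem sum_exp_pos {ι : Type*} [Fintype ι] [Nonempty ι] (β : ℝ) (w : ι → ℝ) :
    0 < ∑ j, Real.exp (β * w j) :=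
  Finset.sum_pos (fun _ _ => Real.exp_pos _) Finset.univ_nonempty

theorem sum_gibbsWeight {ι : Type*} [Fintype ι] [Nonempty ι] (β : ℝ) (w : ι → ℝ) :
    ∑ i, gibbsWeight β w i = 1 := by
  simp_rw [gibbsWeight, ← Finset.sum_div]
  exact div_self (sum_exp_pos β w).ne'

theorem abs_sum_gibbsWeight_mul_le {ι : Type*} [Fintype ι] [Nonempty ι] (β : ℝ) (w : ι → ℝ)
    {u : ι → ℝ} {V : ℝ} (hu : ∀ i, |u i| ≤ V) : |∑ i, gibbsWeight β w i * u i| ≤ V := by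
  calc _ ≤ ∑ i, gibbsWeight β w i * V := by
        refine (Finset.abs_sum_le_sum_abs _ _).trans (Finset.sum_le_sum fun i _ => ?_)
        rw [abs_mul, abs_of_nonneg (gibbsWeight_nonneg β w i)]
        exact mul_le_mul_of_nonneg_left (hu i) (gibbsWeight_nonneg β w i)
    _ = V := by rw [← Finset.sum_mul, sum_gibbsWeight, one_mul]

theorem hasDerivAt_sum_exp {ι : Type*} [Fintype ι] (β : ℝ) (w v u : ι → ℝ) (s : ℝ) :
    HasDerivAt (fun s => ∑ i, Real.exp (β * (w + s • v) i) * u i)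
      (∑ i, Real.exp (β * (w + s • v) i) * (β * v i * u i)) s := by
  apply HasDerivAt.fun_sum
  intro i _
  have h : HasDerivAt (fun s : ℝ => β * (w + s • v) i) (β * v i) s := by
    have := ((hasDerivAt_id s).mul_const (v i)).const_add (w i) |>.const_mul β
    simpa using this
  refine (h.exp.mul_const (u i)).congr_deriv ?_
  ring

theorem hasDerivAt_log_sum_exp {ι : Type*} [Fintype ι] [Nonempty ι] (β : ℝ) (w v : ι → ℝ)
    (s : ℝ) :
    HasDerivAt (fun s => Real.log (∑ i, Real.exp (β * (w + s • v) i)))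
      (∑ i, gibbsWeight β (w + s • v) i * (β * v i)) s := by
  have h := (hasDerivAt_sum_exp β w v (fun _ => 1) s)
  simp only [mul_one] at h
  refine (h.log (sum_exp_pos β _).ne').congr_deriv ?_
  simp_rw [gibbsWeight, Finset.sum_div]
  exact Finset.sum_congr rfl fun i _ => by ring

theorem hasDerivAt_gibbsWeight_sum {ι : Type*} [Fintype ι] [Nonempty ι] (β : ℝ) (w v u : ι → ℝ)
    (s : ℝ) :
    HasDerivAt (fun s => ∑ i, gibbsWeight β (w + s • v) i * u i)
      (∑ i, gibbsWeight β (w + s • v) i * (β * v i * u i)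
        - (∑ i, gibbsWeight β (w + s • v) i * u i)
          * ∑ i, gibbsWeight β (w + s • v) i * (β * v i)) s := by
  have e (x u : ι → ℝ) : ∑ i, gibbsWeight β x i * u i
      = (∑ i, Real.exp (β * x i) * u i) / ∑ i, Real.exp (β * x i) := by
    simp_rw [gibbsWeight, Finset.sum_div]
    exact Finset.sum_congr rfl fun i _ => by ring
  have h := (hasDerivAt_sum_exp β w v (fun _ => 1) s)
  simp only [mul_one] at h
  have hp := (sum_exp_pos β (w + s • v)).ne'
  simp_rw [e]
  refine ((hasDerivAt_sum_exp β w v u s).fun_div h hp).congr_deriv ?_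
  field_simp

theorem abs_comp_log_sum_exp_taylor_le {ι : Type*} [Fintype ι] [Nonempty ι] [DecidableEq ι]
    {G G1 G2 G3 : ℝ → ℝ}
    (h0 : ∀ s, HasDerivAt G (G1 s) s) (h1 : ∀ s, HasDerivAt G1 (G2 s) s)
    (h2 : ∀ s, HasDerivAt G2 (G3 s) s) {c1 c2 c3 : ℝ} (b1 : ∀ s, |G1 s| ≤ c1)
    (b2 : ∀ s, |G2 s| ≤ c2) (b3 : ∀ s, |G3 s| ≤ c3) {β : ℝ} (hβ : 0 ≤ β) (w v : ι → ℝ) :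
    |G (Real.log (∑ i, Real.exp (β * (w + v) i)))
      - (G (Real.log (∑ i, Real.exp (β * w i)))
        + ∑ i, (G1 (Real.log (∑ i, Real.exp (β * w i))) * β * gibbsWeight β w i) * v i
        + 1 / 2 * ∑ i, ∑ j, (β ^ 2 * ((G2 (Real.log (∑ i, Real.exp (β * w i)))
            - G1 (Real.log (∑ i, Real.exp (β * w i)))) * gibbsWeight β w i * gibbsWeight β w j
            + if i = j then G1 (Real.log (∑ i, Real.exp (β * w i))) * gibbsWeight β w i else 0))
              * (v i * v j))|
      ≤ (β ^ 3 * (c3 + 6 * c2 + 6 * c1)) * ‖v‖ ^ 3 := by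
  set L : ℝ → ℝ := fun s => Real.log (∑ i, Real.exp (β * (w + s • v) i)) with hL
  set a : ℝ → ℝ := fun s => ∑ i, gibbsWeight β (w + s • v) i * (β * v i) with ha
  set b : ℝ → ℝ := fun s => ∑ i, gibbsWeight β (w + s • v) i * (β * v i * (β * v i)) with hb
  set c : ℝ → ℝ := fun s =>
    ∑ i, gibbsWeight β (w + s • v) i * (β * v i * (β * v i * (β * v i))) with hc
  have dL (s) : HasDerivAt L (a s) s := hasDerivAt_log_sum_exp β w v s
  have da (s) : HasDerivAt a (b s - a s * a s) s := hasDerivAt_gibbsWeight_sum β w v _ s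
  have db (s) : HasDerivAt b (c s - b s * a s) s := hasDerivAt_gibbsWeight_sum β w v _ s
  set V := β * ‖v‖ with hV
  have hV0 : 0 ≤ V := by positivity
  have hv (i) : |β * v i| ≤ V := by
    rw [abs_mul, abs_of_nonneg hβ]
    exact mul_le_mul_of_nonneg_left (norm_le_pi_norm v i) hβ
  have hv2 (i) : |β * v i * (β * v i)| ≤ V ^ 2 := by
    rw [abs_mul, sq]; exact mul_le_mul (hv i) (hv i) (abs_nonneg _) hV0
  have hv3 (i) : |β * v i * (β * v i * (β * v i))| ≤ V ^ 3 := by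
    rw [abs_mul, show V ^ 3 = V * V ^ 2 by ring]
    exact mul_le_mul (hv i) (hv2 i) (abs_nonneg _) hV0
  have ba (s) : |a s| ≤ V := abs_sum_gibbsWeight_mul_le β _ hv
  have bb (s) : |b s| ≤ V ^ 2 := abs_sum_gibbsWeight_mul_le β _ hv2
  have bc (s) : |c s| ≤ V ^ 3 := abs_sum_gibbsWeight_mul_le β _ hv3
  have key := abs_sub_taylor_two_le (φ := fun s => G (L s)) (φ1 := fun s => G1 (L s) * a s)
    (φ2 := fun s => G2 (L s) * a s ^ 2 + G1 (L s) * (b s - a s * a s))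
    (φ3 := fun s => G3 (L s) * a s ^ 3 + 3 * (G2 (L s) * (a s * (b s - a s * a s)))
      + G1 (L s) * (c s - b s * a s - 2 * (a s * (b s - a s * a s))))
    (K := (β ^ 3 * (c3 + 6 * c2 + 6 * c1)) * ‖v‖ ^ 3)
    (fun s => (h0 _).comp s (dL s))
    (fun s => by
      refine (((h1 _).comp s (dL s)).fun_mul (da s)).congr_deriv ?_
      simp only [Function.comp_apply]
      ring)
    (fun s => by
      refine ((((h2 _).comp s (dL s)).fun_mul ((da s).fun_pow 2)).fun_add
        (((h1 _).comp s (dL s)).fun_mul ((db s).fun_sub ((da s).fun_mul (da s))))).congr_deriv ?_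
      simp only [Function.comp_apply]
      push_cast
      ring)
    (fun s => by
      have t1 : |G3 (L s) * a s ^ 3| ≤ c3 * V ^ 3 := by
        rw [abs_mul, abs_pow]
        exact mul_le_mul (b3 _) (pow_le_pow_left₀ (abs_nonneg _) (ba s) 3) (by positivity)
          ((abs_nonneg _).trans (b3 0))
      have t0 : |b s - a s * a s| ≤ 2 * V ^ 2 := by
        have : |a s * a s| ≤ V ^ 2 := by
          rw [abs_mul, sq]; exact mul_le_mul (ba s) (ba s) (abs_nonneg _) hV0
        have := abs_sub (b s) (a s * a s)
        linarith [bb s]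
      have t2 : |a s * (b s - a s * a s)| ≤ 2 * V ^ 3 := by
        rw [abs_mul, show 2 * V ^ 3 = V * (2 * V ^ 2) by ring]
        exact mul_le_mul (ba s) t0 (abs_nonneg _) hV0
      have t3 : |G2 (L s) * (a s * (b s - a s * a s))| ≤ c2 * (2 * V ^ 3) := by
        rw [abs_mul]
        exact mul_le_mul (b2 _) t2 (abs_nonneg _) ((abs_nonneg _).trans (b2 0))
      have t4 : |b s * a s| ≤ V ^ 3 := by
        rw [abs_mul, show V ^ 3 = V ^ 2 * V by ring]
        exact mul_le_mul (bb s) (ba s) (abs_nonneg _) (by positivity)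
      have t5 : |c s - b s * a s - 2 * (a s * (b s - a s * a s))| ≤ 6 * V ^ 3 := by
        have := bc s
        rw [abs_le] at *
        constructor <;> linarith
      have t6 : |G1 (L s) * (c s - b s * a s - 2 * (a s * (b s - a s * a s)))|
          ≤ c1 * (6 * V ^ 3) := by
        rw [abs_mul]
        exact mul_le_mul (b1 _) t5 (abs_nonneg _) ((abs_nonneg _).trans (b1 0))
      have e : (β ^ 3 * (c3 + 6 * c2 + 6 * c1)) * ‖v‖ ^ 3
          = c3 * V ^ 3 + 3 * (c2 * (2 * V ^ 3)) + c1 * (6 * V ^ 3) := by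
        rw [hV]; ring
      rw [e]
      rw [abs_le] at *
      constructor <;> linarith)
  convert key using 2
  simp only [hL, ha, hb, one_smul, zero_smul, add_zero]
  congr 2
  · congr 1
    rw [Finset.mul_sum]
    exact Finset.sum_congr rfl fun i _ => by ring
  · congr 1
    have sq1 : (∑ i, gibbsWeight β w i * (β * v i)) ^ 2
        = ∑ i, ∑ j, gibbsWeight β w i * (β * v i) * (gibbsWeight β w j * (β * v j)) := by
      rw [sq, Finset.sum_mul_sum]
    have dg (g1 : ℝ) : g1 * ∑ i, gibbsWeight β w i * (β * v i * (β * v i))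
        = ∑ i, ∑ j, β ^ 2 * (if i = j then g1 * gibbsWeight β w i else 0) * (v i * v j) := by
      rw [Finset.mul_sum]
      refine Finset.sum_congr rfl fun i _ => ?_
      rw [Finset.sum_eq_single i]
      · simp; ring
      · intro j _ hj; simp [hj.symm]
      · simp
    rw [mul_sub, ← sq, dg, sq1, Finset.mul_sum, Finset.mul_sum, ← Finset.sum_sub_distrib,
      ← Finset.sum_add_distrib]
    refine Finset.sum_congr rfl fun i _ => ?_
    rw [Finset.mul_sum, Finset.mul_sum, ← Finset.sum_sub_distrib, ← Finset.sum_add_distrib]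
    refine Finset.sum_congr rfl fun j _ => ?_
    ring

theorem sum_abs_softmax_hessian_le {ι : Type*} [Fintype ι] [Nonempty ι] [DecidableEq ι]
    {x1 x2 c1 c2 : ℝ} (b1 : |x1| ≤ c1) (b2 : |x2| ≤ c2) (β : ℝ) (w : ι → ℝ) :
    ∑ i, ∑ j, |β ^ 2 * ((x2 - x1) * gibbsWeight β w i * gibbsWeight β w j
      + if i = j then x1 * gibbsWeight β w i else 0)| ≤ β ^ 2 * (c2 + 2 * c1) := by
  have hx : |x2 - x1| ≤ c2 + c1 := (abs_sub _ _).trans (add_le_add b2 b1)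
  calc _ ≤ ∑ i, ∑ j, β ^ 2 * ((c2 + c1) * (gibbsWeight β w i * gibbsWeight β w j)
      + if i = j then c1 * gibbsWeight β w i else 0) := by
        refine Finset.sum_le_sum fun i _ => Finset.sum_le_sum fun j _ => ?_
        rw [abs_mul, abs_of_nonneg (sq_nonneg β)]
        refine mul_le_mul_of_nonneg_left ((abs_add_le _ _).trans (add_le_add ?_ ?_)) (sq_nonneg β)
        · have := mul_nonneg (gibbsWeight_nonneg β w i) (gibbsWeight_nonneg β w j)
          rw [mul_assoc, abs_mul, abs_of_nonneg this]
          exact mul_le_mul_of_nonneg_right hx this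
        · split_ifs
          · rw [abs_mul, abs_of_nonneg (gibbsWeight_nonneg β w i)]
            exact mul_le_mul_of_nonneg_right b1 (gibbsWeight_nonneg β w i)
          · simp
    _ = _ := by
        simp_rw [← Finset.mul_sum, Finset.sum_add_distrib, ← Finset.mul_sum, sum_gibbsWeight]
        simp [← Finset.mul_sum, sum_gibbsWeight]
        ring_nf
        simp

theorem exists_smooth_step : ∃ (S S1 S2 S3 : ℝ → ℝ) (c : ℝ), 0 < c ∧
    (∀ s, HasDerivAt S (S1 s) s) ∧ (∀ s, HasDerivAt S1 (S2 s) s) ∧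
    (∀ s, HasDerivAt S2 (S3 s) s) ∧ (∀ s, |S1 s| ≤ c) ∧ (∀ s, |S2 s| ≤ c) ∧ (∀ s, |S3 s| ≤ c) ∧
    (∀ s, 0 ≤ S s) ∧ (∀ s, S s ≤ 1) ∧ (∀ s ≤ 0, S s = 0) ∧ (∀ s, 1 ≤ s → S s = 1) := by
  have hS : ContDiff ℝ (⊤ : ℕ∞) Real.smoothTransition := Real.smoothTransition.contDiff
  have h1 : ContDiff ℝ (⊤ : ℕ∞) (deriv Real.smoothTransition) :=
    (contDiff_infty_iff_deriv.1 hS).2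
  have h2 : ContDiff ℝ (⊤ : ℕ∞) (deriv (deriv Real.smoothTransition)) :=
    (contDiff_infty_iff_deriv.1 h1).2
  have h3 : ContDiff ℝ (⊤ : ℕ∞) (deriv (deriv (deriv Real.smoothTransition))) :=
    (contDiff_infty_iff_deriv.1 h2).2
  have cs : HasCompactSupport (deriv Real.smoothTransition) := by
    refine HasCompactSupport.intro (isCompact_Icc (a := (0 : ℝ)) (b := 1)) fun x hx => ?_
    by_cases h : x < 0
    · have : Real.smoothTransition =ᶠ[nhds x] fun _ => 0 := by
        filter_upwards [Iio_mem_nhds h] with y hy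
        exact Real.smoothTransition.zero_of_nonpos (le_of_lt hy)
      rw [this.deriv_eq]; simp
    · have h' : 1 < x := by
        by_contra h'
        exact hx ⟨not_lt.1 h, not_lt.1 h'⟩
      have : Real.smoothTransition =ᶠ[nhds x] fun _ => 1 := by
        filter_upwards [Ioi_mem_nhds h'] with y hy
        exact Real.smoothTransition.one_of_one_le (le_of_lt hy)
      rw [this.deriv_eq]; simp
  obtain ⟨d1, hd1⟩ := cs.exists_bound_of_continuous h1.continuous
  obtain ⟨d2, hd2⟩ := cs.deriv.exists_bound_of_continuous h2.continuous
  obtain ⟨d3, hd3⟩ := cs.deriv.deriv.exists_bound_of_continuous h3.continuous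
  have p1 := (norm_nonneg _).trans (hd1 0)
  have p2 := (norm_nonneg _).trans (hd2 0)
  have p3 := (norm_nonneg _).trans (hd3 0)
  refine ⟨Real.smoothTransition, _, _, _, d1 + d2 + d3 + 1, by positivity,
    fun s => ((hS.differentiable (by simp)) s).hasDerivAt,
    fun s => ((h1.differentiable (by simp)) s).hasDerivAt,
    fun s => ((h2.differentiable (by simp)) s).hasDerivAt,
    fun s => (hd1 s).trans (by linarith), fun s => (hd2 s).trans (by linarith),
    fun s => (hd3 s).trans (by linarith), Real.smoothTransition.nonneg,
    Real.smoothTransition.le_one, fun s => Real.smoothTransition.zero_of_nonpos,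
    fun s => Real.smoothTransition.one_of_one_le⟩

/-- Smoothed comparison of the laws of maxima of two centered Gaussian vectors. -/
theorem exists_measureReal_forall_le_le_add : ∃ c : ℝ, 0 < c ∧
    ∀ {ι : Type} [Fintype ι] [Nonempty ι] {μ ν : Measure (ι → ℝ)} [IsGaussian μ] [IsGaussian ν]
      (_ : μ[id] = 0) (_ : ν[id] = 0) {Δ : ℝ} (_ : 0 ≤ Δ)
      (_ : ∀ i j, |∫ x, x i * x j ∂μ - ∫ x, x i * x j ∂ν| ≤ Δ)
      (_ : 1 ≤ Real.log (Fintype.card ι)) (t : ℝ) {ε : ℝ} (_ : 0 < ε),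
      μ.real {x | ∀ i, x i ≤ t} ≤ ν.real {x | ∀ i, x i ≤ t + ε}
        + c * Δ * Real.log (Fintype.card ι) / ε ^ 2 := by
  obtain ⟨S, S1, S2, S3, c, hc, d0, d1, d2, b1, b2, b3, S0, Sle, Sz, So⟩ := exists_smooth_step
  refine ⟨6 * c, by positivity, ?_⟩
  intro ι _ _ μ ν _ _ hμ hν Δ hΔ0 hΔ hl t ε hε
  classical
  set l := Real.log (Fintype.card ι) with hldef
  have hl0 : 0 < l := by linarith
  set β := 2 * l / ε with hβ
  have hβ0 : 0 < β := by positivity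
  have hβε : β * ε = 2 * l := by rw [hβ]; field_simp
  have dlin (s : ℝ) : HasDerivAt (fun u : ℝ => (u - (β * t + l)) / l) (1 / l) s :=
    ((hasDerivAt_id s).sub_const _).div_const l
  have chain {F F' : ℝ → ℝ} (hF : ∀ s, HasDerivAt F (F' s) s) (k s : ℝ) :
      HasDerivAt (fun u => k * F ((u - (β * t + l)) / l))
        (k / l * F' ((s - (β * t + l)) / l)) s := by
    refine (((hF _).comp s (dlin s)).const_mul k).congr_deriv ?_
    ring
  set G : ℝ → ℝ := fun u => 1 + -1 * S ((u - (β * t + l)) / l) with hG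
  set f : (ι → ℝ) → ℝ := fun w => G (Real.log (∑ i, Real.exp (β * w i))) with hf
  have G01 (u) : 0 ≤ G u ∧ G u ≤ 1 := by
    have := S0 ((u - (β * t + l)) / l)
    have := Sle ((u - (β * t + l)) / l)
    simp only [hG]; constructor <;> linarith
  have fc : Continuous f := by
    have hGc : Continuous G := by
      have hSc : Continuous S := continuous_iff_continuousAt.2 fun s => (d0 s).continuousAt
      simp only [hG]
      fun_prop
    refine hGc.comp (Continuous.log (by fun_prop) fun w => (sum_exp_pos β w).ne')
  have bd {F : ℝ → ℝ} (hF : ∀ s, |F s| ≤ c) (k s : ℝ) :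
      |k * F ((s - (β * t + l)) / l)| ≤ |k| * c := by
    rw [abs_mul]
    exact mul_le_mul_of_nonneg_left (hF _) (abs_nonneg _)
  have g0 : ∀ s, HasDerivAt G (-1 / l * S1 ((s - (β * t + l)) / l)) s := fun s => by
    simpa only [hG] using (chain d0 (-1) s).const_add 1
  have comp := abs_integral_sub_le_of_taylor hμ hν (f := f) fc (B := 1)
    (fun x => abs_le.2 ⟨by linarith [(G01 (Real.log (∑ i, Real.exp (β * x i)))).1],
      (G01 _).2⟩) (K := β ^ 3 * (|-1 / l / l / l| * c + 6 * (|-1 / l / l| * c) + 6 * (|-1 / l| * c)))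
    (M := β ^ 2 * (|-1 / l / l| * c + 2 * (|-1 / l| * c)))
    (fun w v => abs_comp_log_sum_exp_taylor_le g0 (fun s => chain d1 _ s) (fun s => chain d2 _ s)
      (fun s => bd b1 _ s) (fun s => bd b2 _ s) (fun s => bd b3 _ s) hβ0.le w v)
    (fun w => sum_abs_softmax_hessian_le (bd b1 _ _) (bd b2 _ _) β w) hΔ0 hΔ
  have hM : 1 / 2 * Δ * (β ^ 2 * (|-1 / l / l| * c + 2 * (|-1 / l| * c)))
      ≤ 6 * c * Δ * l / ε ^ 2 := by
    have e1 : |-1 / l| = 1 / l := by rw [abs_div, abs_neg, abs_one, abs_of_pos hl0]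
    have e2 : |-1 / l / l| ≤ 1 / l := by
      rw [abs_div, e1, abs_of_pos hl0]
      exact div_le_self (by positivity) hl
    rw [e1]
    calc _ ≤ 1 / 2 * Δ * (β ^ 2 * (1 / l * c + 2 * (1 / l * c))) := by gcongr
      _ = _ := by rw [hβ]; field_simp; ring
  have comp' := (abs_le.1 (comp.trans hM)).2
  have mA (s : ℝ) : MeasurableSet {x : ι → ℝ | ∀ i, x i ≤ s} := by
    rw [Set.ofPred_forall]
    exact MeasurableSet.iInter fun i => measurableSet_le (by fun_prop) (by fun_prop)
  have ib (ρ : Measure (ι → ℝ)) [IsProbabilityMeasure ρ] : Integrable f ρ :=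
    Integrable.of_bound fc.aestronglyMeasurable 1 (.of_forall fun x =>
      abs_le.2 ⟨by linarith [(G01 (Real.log (∑ i, Real.exp (β * x i)))).1], (G01 _).2⟩)
  have lo : μ.real {x | ∀ i, x i ≤ t} ≤ ∫ x, f x ∂μ := by
    rw [← integral_indicator_one (mA t)]
    refine integral_mono ((integrable_const (1 : ℝ)).indicator (mA t)) (ib μ) fun x => ?_
    by_cases hx : x ∈ {x : ι → ℝ | ∀ i, x i ≤ t}
    swap
    · rw [Set.indicator_of_notMem hx]
      exact (G01 _).1
    rw [Set.indicator_of_mem hx]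
    have h1 : ∑ i, Real.exp (β * x i) ≤ Fintype.card ι * Real.exp (β * t) := by
      rw [← nsmul_eq_mul]
      exact Finset.sum_le_card_nsmul _ _ _ fun i _ =>
        Real.exp_le_exp.2 (mul_le_mul_of_nonneg_left (hx i) hβ0.le)
    have h2 : Real.log (∑ i, Real.exp (β * x i)) ≤ β * t + l := by
      refine (Real.log_le_log (sum_exp_pos β x) h1).trans ?_
      rw [Real.log_mul (by simp) (Real.exp_pos _).ne', Real.log_exp, add_comm]
    have h3 := Sz ((Real.log (∑ i, Real.exp (β * x i)) - (β * t + l)) / l)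
      (div_nonpos_of_nonpos_of_nonneg (by linarith) hl0.le)
    simp [hf, hG, h3]
  have hi : ∫ x, f x ∂ν ≤ ν.real {x | ∀ i, x i ≤ t + ε} := by
    rw [← integral_indicator_one (mA (t + ε))]
    refine integral_mono (ib ν) ((integrable_const (1 : ℝ)).indicator (mA _)) fun x => ?_
    by_cases hx : x ∈ {x : ι → ℝ | ∀ i, x i ≤ t + ε}
    · rw [Set.indicator_of_mem hx]
      exact (G01 _).2
    rw [Set.indicator_of_notMem hx]
    simp only [Set.mem_ofPred_eq, not_forall, not_le] at hx
    obtain ⟨i, hi⟩ := hx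
    have h1 : Real.exp (β * x i) ≤ ∑ i, Real.exp (β * x i) :=
      Finset.single_le_sum (f := fun i => Real.exp (β * x i)) (fun _ _ => (Real.exp_pos _).le)
        (Finset.mem_univ i)
    have h2 := Real.log_le_log (Real.exp_pos _) h1
    rw [Real.log_exp] at h2
    have h4 : β * t + 2 * l ≤ β * x i := by
      rw [← hβε, ← mul_add]
      exact mul_le_mul_of_nonneg_left hi.le hβ0.le
    have h3 := So ((Real.log (∑ i, Real.exp (β * x i)) - (β * t + l)) / l)
      ((one_le_div hl0).2 (by linarith))
    simp [hf, hG, h3]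
  linarith

theorem gaussianReal_real_Ioc_le {u v m : ℝ} (huv : u ≤ v)
    (h : ∀ x ∈ Set.Ioc u v, gaussianPDFReal 0 1 x ≤ m) :
    (gaussianReal 0 1).real (Set.Ioc u v) ≤ m * (v - u) := by
  have h0 : 0 ≤ ∫ x in Set.Ioc u v, gaussianPDFReal 0 1 x :=
    integral_nonneg fun x => gaussianPDFReal_nonneg _ _ _
  rw [measureReal_def, gaussianReal_apply_eq_integral _ one_ne_zero, ENNReal.toReal_ofReal h0]
  have := setIntegral_mono_on (μ := volume) (s := Set.Ioc u v)
    (integrable_gaussianPDFReal 0 1).integrableOn (g := fun _ => m)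
    (integrableOn_const (by simp)) measurableSet_Ioc h
  refine this.trans_eq ?_
  rw [setIntegral_const, Real.volume_real_Ioc_of_le huv, smul_eq_mul, mul_comm]

theorem le_gaussianReal_real_Ioc {u v m : ℝ} (huv : u ≤ v)
    (h : ∀ x ∈ Set.Ioc u v, m ≤ gaussianPDFReal 0 1 x) :
    m * (v - u) ≤ (gaussianReal 0 1).real (Set.Ioc u v) := by
  have h0 : 0 ≤ ∫ x in Set.Ioc u v, gaussianPDFReal 0 1 x :=
    integral_nonneg fun x => gaussianPDFReal_nonneg _ _ _
  rw [measureReal_def, gaussianReal_apply_eq_integral _ one_ne_zero, ENNReal.toReal_ofReal h0]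
  have := setIntegral_ge_of_const_le_real (μ := volume) measurableSet_Ioc (by simp) h
    (integrable_gaussianPDFReal 0 1).integrableOn
  rwa [Real.volume_real_Ioc_of_le huv] at this

theorem gaussianPDFReal_zero_one (x : ℝ) :
    gaussianPDFReal 0 1 x = (√(2 * Real.pi))⁻¹ * Real.exp (-x ^ 2 / 2) := by
  simp [gaussianPDFReal]

theorem gaussianPDFReal_zero_one_le {x y : ℝ} (hx : 0 ≤ x) (hxy : x ≤ y) :
    gaussianPDFReal 0 1 y ≤ gaussianPDFReal 0 1 x := by
  rw [gaussianPDFReal_zero_one, gaussianPDFReal_zero_one]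
  have : x ^ 2 ≤ y ^ 2 := pow_le_pow_left₀ hx hxy 2
  gcongr

/-- The standard Gaussian mass of a short interval is controlled by the mass to its right,
up to an error which is small if the interval lies far to the right. -/
theorem gaussianReal_real_Ioc_le_mul_Ici_add {a η : ℝ} (ha : 0 ≤ a) (hη : 0 ≤ η)
    (h1 : η * (a + 1) ≤ 1) (τ : ℝ) :
    (gaussianReal 0 1).real (Set.Ioc τ (τ + η))
      ≤ Real.exp 4 * (η * (a + 1)) * (gaussianReal 0 1).real (Set.Ici (τ + η))
        + η * Real.exp (-a ^ 2 / 2) := by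
  have hτ : τ ≤ τ + η := by linarith
  rcases le_or_gt τ a with hτa | hτa
  · set m := max τ 0
    set δ := 1 / (a + 1)
    have hm0 : 0 ≤ m := le_max_right _ _
    have hτm : τ ≤ m := le_max_left _ _
    have hma : m ≤ a := max_le hτa ha
    have hδ0 : 0 < δ := by positivity
    have hδ1 : δ ≤ 1 := (div_le_one (by linarith)).2 (by linarith)
    have hδa : δ * (a + 1) = 1 := by simp only [δ]; field_simp
    have hηδ : η ≤ δ := (le_div_iff₀ (by linarith)).2 h1
    have hup : (gaussianReal 0 1).real (Set.Ioc τ (τ + η)) ≤ gaussianPDFReal 0 1 m * η := by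
      refine (gaussianReal_real_Ioc_le (m := gaussianPDFReal 0 1 m) hτ fun x hx => ?_).trans_eq
        (by ring)
      rcases le_total τ 0 with h0 | h0
      · have : m = 0 := max_eq_right h0
        rw [this, gaussianPDFReal_zero_one, gaussianPDFReal_zero_one]
        exact mul_le_mul_of_nonneg_left (Real.exp_le_exp.2 (by linarith [sq_nonneg x]))
          (by positivity)
      · exact gaussianPDFReal_zero_one_le hm0 (max_le hx.1.le (h0.trans hx.1.le))
    have hlow : gaussianPDFReal 0 1 (m + 2 * δ) * δ
        ≤ (gaussianReal 0 1).real (Set.Ici (τ + η)) := by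
      have := le_gaussianReal_real_Ioc (u := m + δ) (v := m + 2 * δ) (by linarith)
        fun x hx => gaussianPDFReal_zero_one_le (by linarith [hx.1]) hx.2
      calc _ = gaussianPDFReal 0 1 (m + 2 * δ) * (m + 2 * δ - (m + δ)) := by ring
        _ ≤ _ := this
        _ ≤ _ := measureReal_mono fun x hx => by
          have := hx.1
          simp only [Set.mem_Ici]
          linarith
    have hφ : gaussianPDFReal 0 1 m ≤ Real.exp 4 * gaussianPDFReal 0 1 (m + 2 * δ) := by
      rw [gaussianPDFReal_zero_one, gaussianPDFReal_zero_one, mul_left_comm, ← Real.exp_add]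
      gcongr
      have : m * δ ≤ 1 := by nlinarith
      nlinarith
    have hη' : 0 ≤ η * Real.exp (-a ^ 2 / 2) := by positivity
    calc _ ≤ gaussianPDFReal 0 1 m * η := hup
      _ ≤ Real.exp 4 * gaussianPDFReal 0 1 (m + 2 * δ) * η := by gcongr
      _ = Real.exp 4 * (η * (a + 1)) * (gaussianPDFReal 0 1 (m + 2 * δ) * δ) := by
        linear_combination (-(Real.exp 4 * gaussianPDFReal 0 1 (m + 2 * δ) * η)) * hδa
      _ ≤ Real.exp 4 * (η * (a + 1)) * (gaussianReal 0 1).real (Set.Ici (τ + η)) := by gcongr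
      _ ≤ _ := by linarith
  · have hup : (gaussianReal 0 1).real (Set.Ioc τ (τ + η)) ≤ Real.exp (-a ^ 2 / 2) * η := by
      refine (gaussianReal_real_Ioc_le (m := Real.exp (-a ^ 2 / 2)) hτ fun x hx => ?_).trans_eq
        (by ring)
      refine (gaussianPDFReal_zero_one_le ha (hτa.trans hx.1).le).trans ?_
      rw [gaussianPDFReal_zero_one]
      refine mul_le_of_le_one_left (Real.exp_pos _).le (inv_le_one_of_one_le₀ ?_)
      rw [Real.one_le_sqrt]
      linarith [Real.pi_gt_three]
    have : 0 ≤ Real.exp 4 * (η * (a + 1)) * (gaussianReal 0 1).real (Set.Ici (τ + η)) := by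
      positivity
    linarith

/-- If `U` is standard Gaussian and independent of `W`, and `A` is an event which is increasing
in `U` for fixed `W`, then `U` is unlikely to fall into a short interval on `A`. -/
theorem measureReal_inter_Ioc_le_of_monotone {Ω E : Type*} [MeasurableSpace Ω] [MeasurableSpace E]
    {P : Measure Ω} [IsProbabilityMeasure P] {W : Ω → E} {U : Ω → ℝ}
    (hU : Measurable U) (hWU : IndepFun W U P) (hlaw : P.map U = gaussianReal 0 1)
    {B : ℝ → Set E} (hB : Monotone B) (hBm : ∀ u, MeasurableSet (B u))
    {a η : ℝ} (ha : 0 ≤ a) (hη : 0 ≤ η) (h1 : η * (a + 1) ≤ 1) (τ : ℝ) :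
    P.real {ω | W ω ∈ B (U ω) ∧ U ω ∈ Set.Ioc τ (τ + η)}
      ≤ Real.exp 4 * (η * (a + 1)) * P.real {ω | W ω ∈ B (U ω)} + η * Real.exp (-a ^ 2 / 2) := by
  have prod (J : Set ℝ) (hJ : MeasurableSet J) :
      P.real (W ⁻¹' B (τ + η) ∩ U ⁻¹' J)
        = P.real (W ⁻¹' B (τ + η)) * (gaussianReal 0 1).real J := by
    rw [measureReal_def, hWU.measure_inter_preimage_eq_mul _ _ (hBm _) hJ, ENNReal.toReal_mul,
      ← hlaw, map_measureReal_apply hU hJ]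
    rfl
  have e1 : P.real {ω | W ω ∈ B (U ω) ∧ U ω ∈ Set.Ioc τ (τ + η)}
      ≤ P.real (W ⁻¹' B (τ + η) ∩ U ⁻¹' Set.Ioc τ (τ + η)) :=
    measureReal_mono fun ω hω => ⟨hB hω.2.2 hω.1, hω.2⟩
  have e2 : P.real (W ⁻¹' B (τ + η) ∩ U ⁻¹' Set.Ici (τ + η)) ≤ P.real {ω | W ω ∈ B (U ω)} :=
    measureReal_mono fun ω hω => hB hω.2 hω.1
  rw [prod _ measurableSet_Ioc] at e1
  rw [prod _ measurableSet_Ici] at e2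
  have e3 := gaussianReal_real_Ioc_le_mul_Ici_add ha hη h1 τ
  have q0 : 0 ≤ P.real (W ⁻¹' B (τ + η)) := measureReal_nonneg
  have q1 : P.real (W ⁻¹' B (τ + η)) ≤ 1 := measureReal_le_one
  calc _ ≤ _ := e1
    _ ≤ P.real (W ⁻¹' B (τ + η)) * (Real.exp 4 * (η * (a + 1)) *
          (gaussianReal 0 1).real (Set.Ici (τ + η)) + η * Real.exp (-a ^ 2 / 2)) := by gcongr
    _ = Real.exp 4 * (η * (a + 1)) * (P.real (W ⁻¹' B (τ + η)) *
          (gaussianReal 0 1).real (Set.Ici (τ + η)))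
        + P.real (W ⁻¹' B (τ + η)) * (η * Real.exp (-a ^ 2 / 2)) := by ring
    _ ≤ Real.exp 4 * (η * (a + 1)) * P.real {ω | W ω ∈ B (U ω)}
        + 1 * (η * Real.exp (-a ^ 2 / 2)) := by gcongr
    _ = _ := by ring

theorem covariance_le_one_of_variance_eq_one {Ω : Type*} [MeasurableSpace Ω] {P : Measure Ω}
    [IsProbabilityMeasure P] {X Y : Ω → ℝ} (hX : MemLp X 2 P) (hY : MemLp Y 2 P)
    (hX1 : Var[X; P] = 1) (hY1 : Var[Y; P] = 1) : cov[X, Y; P] ≤ 1 := by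
  have h := variance_sub hX hY
  have := variance_nonneg (X - Y) P
  linarith

theorem measurableSet_le_and_imp_lt {E : Type*} [MeasurableSpace E] {f g : E → ℝ} (p : Prop)
    (hf : Measurable f) (hg : Measurable g) :
    MeasurableSet {x | f x ≤ g x ∧ (p → f x < g x)} := by
  by_cases h : p
  · have : {x | f x ≤ g x ∧ (p → f x < g x)} = {x | f x < g x} := by
      ext x
      simpa [h] using le_of_lt
    rw [this]
    exact measurableSet_lt hf hg
  · simpa [h] using measurableSet_le hf hg

/-- The event that the `j`-th of the standardized and centred coordinates `(x i - t) / σ i` is the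
largest, with ties broken by `e`. -/
def argmaxEvent {ι : Type*} (σ : ι → ℝ) (t : ℝ) (e : ι → ℕ) (j : ι) : Set (ι → ℝ) :=
  {x | ∀ i, (x i - t) / σ i ≤ (x j - t) / σ j ∧
    (e j < e i → (x i - t) / σ i < (x j - t) / σ j)}

theorem measurableSet_argmaxEvent {ι : Type*} [Finite ι] (σ : ι → ℝ) (t : ℝ) (e : ι → ℕ) (j : ι) :
    MeasurableSet (argmaxEvent σ t e j) := by
  unfold argmaxEvent
  rw [Set.ofPred_forall]
  refine MeasurableSet.iInter fun i => ?_
  exact measurableSet_le_and_imp_lt _ (by fun_prop) (by fun_prop)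

theorem disjoint_argmaxEvent {ι : Type*} (σ : ι → ℝ) (t : ℝ) {e : ι → ℕ}
    (he : Function.Injective e) {j k : ι} (hjk : j ≠ k) :
    Disjoint (argmaxEvent σ t e j) (argmaxEvent σ t e k) := by
  rw [Set.disjoint_left]
  intro x hj hk
  rcases lt_or_gt_of_ne (he.ne hjk) with h | h
  · exact absurd ((hj k).2 h) (not_lt.2 (hk j).1)
  · exact absurd ((hk j).2 h) (not_lt.2 (hj k).1)

theorem exists_mem_argmaxEvent {ι : Type*} [Finite ι] [Nonempty ι] (σ : ι → ℝ) (t : ℝ)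
    (e : ι → ℕ) (x : ι → ℝ) : ∃ j, x ∈ argmaxEvent σ t e j := by
  obtain ⟨j, hj⟩ := Finite.exists_max fun i => toLex ((x i - t) / σ i, e i)
  refine ⟨j, fun i => ?_⟩
  have := Prod.Lex.le_iff.1 (hj i)
  simp only [ofLex_toLex] at this
  rcases this with h | ⟨h, h'⟩
  · exact ⟨h.le, fun _ => h⟩
  · exact ⟨h.le, fun h2 => absurd h2 (not_lt.2 h')⟩

theorem measureReal_argmaxEvent_inter_Ioc_le {ι : Type*} [Fintype ι] {ν : Measure (ι → ℝ)}
    [IsGaussian ν] (hν : ν[id] = 0) {σ : ι → ℝ} (hσ : ∀ i, 0 < σ i)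
    (hvar : ∀ i, ∫ x, x i * x i ∂ν = σ i ^ 2) (t : ℝ) (e : ι → ℕ) (j : ι)
    {a η : ℝ} (ha : 0 ≤ a) (hη : 0 ≤ η) (h1 : η * (a + 1) ≤ 1) :
    ν.real {x | x ∈ argmaxEvent σ t e j ∧ (x j - t) / σ j ∈ Set.Ioc 0 η}
      ≤ Real.exp 4 * (η * (a + 1)) * ν.real (argmaxEvent σ t e j)
        + η * Real.exp (-a ^ 2 / 2) := by
  set X : ι → (ι → ℝ) → ℝ := fun i x => (σ i)⁻¹ * x i with hX
  have hL (i) : HasGaussianLaw (X i) ν :=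
    (IsGaussian.hasGaussianLaw_id (μ := ν)).map
      ((σ i)⁻¹ • ContinuousLinearMap.proj (R := ℝ) (φ := fun _ : ι => ℝ) i)
  have hL2 (i) : MemLp (X i) 2 ν := (hL i).memLp_two
  have hmean0 (i) : ∫ x, x i ∂ν = 0 := by
    have := ContinuousLinearMap.integral_comp_comm
      (ContinuousLinearMap.proj (R := ℝ) (φ := fun _ : ι => ℝ) i)
      (IsGaussian.hasGaussianLaw_id (μ := ν)).integrable
    rw [hν] at this
    simpa using this
  have hmean (i) : ν[X i] = 0 := by
    simp only [hX, integral_const_mul, hmean0, mul_zero]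
  have hvar1 (i) : Var[X i; ν] = 1 := by
    rw [variance_of_integral_eq_zero (hL i).aemeasurable (hmean i)]
    have : ∀ x : ι → ℝ, X i x ^ 2 = (σ i ^ 2)⁻¹ * (x i * x i) := fun x => by
      simp only [hX]; ring
    simp only [this, integral_const_mul, hvar]
    exact inv_mul_cancel₀ (pow_pos (hσ i) 2).ne'
  set ρ : ι → ℝ := fun i => cov[X i, X j; ν] with hρ
  have hρ1 (i) : ρ i ≤ 1 :=
    covariance_le_one_of_variance_eq_one (hL2 i) (hL2 j) (hvar1 i) (hvar1 j)
  have hind : IndepFun (fun x i => X i x - ρ i * X j x) (fun x (_ : Unit) => X j x) ν := by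
    apply HasGaussianLaw.indepFun_of_covariance_eval (X := fun i x => X i x - ρ i * X j x)
      (Y := fun _ : Unit => X j)
    · exact (IsGaussian.hasGaussianLaw_id (μ := ν)).map
        ((ContinuousLinearMap.pi fun i =>
          ((σ i)⁻¹ • ContinuousLinearMap.proj (R := ℝ) (φ := fun _ : ι => ℝ) i
            - ρ i • (σ j)⁻¹ • ContinuousLinearMap.proj (R := ℝ) (φ := fun _ : ι => ℝ) j)).prod
        (ContinuousLinearMap.pi fun _ : Unit =>
          (σ j)⁻¹ • ContinuousLinearMap.proj (R := ℝ) (φ := fun _ : ι => ℝ) j))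
    · intro i _
      rw [covariance_fun_sub_left (hL2 i) ((hL2 j).const_mul _) (hL2 j),
        covariance_const_mul_left (X := X j), covariance_self (hL j).aemeasurable, hvar1, mul_one,
        sub_self]
  set W : (ι → ℝ) → ι → ℝ := fun x i => X i x - ρ i * X j x - t / σ i + t / σ j with hW
  have hWU : IndepFun W (X j) ν :=
    hind.comp (φ := fun (w : ι → ℝ) i => w i - t / σ i + t / σ j) (ψ := fun u : Unit → ℝ => u ())
      (by fun_prop) (by fun_prop)
  have hlaw : ν.map (X j) = gaussianReal 0 1 := by
    rw [(hL j).map_eq_gaussianReal, hmean, hvar1]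
    simp
  set B : ℝ → Set (ι → ℝ) := fun u =>
    {w | ∀ i, w i ≤ (1 - ρ i) * u ∧ (e j < e i → w i < (1 - ρ i) * u)} with hB
  have hBmono : Monotone B := fun u v huv w hw i => by
    have : (1 - ρ i) * u ≤ (1 - ρ i) * v :=
      mul_le_mul_of_nonneg_left huv (by linarith [hρ1 i])
    exact ⟨(hw i).1.trans this, fun h => ((hw i).2 h).trans_le this⟩
  have hBm (u) : MeasurableSet (B u) := by
    simp only [hB]
    rw [Set.ofPred_forall]
    refine MeasurableSet.iInter fun i => ?_
    exact measurableSet_le_and_imp_lt _ (by fun_prop) (by fun_prop)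
  have hA : {x | W x ∈ B (X j x)} = argmaxEvent σ t e j := by
    ext x
    refine forall_congr' fun i => ?_
    have e1 : W x i - (1 - ρ i) * X j x = (x i - t) / σ i - (x j - t) / σ j := by
      simp only [hW, hX]
      ring
    refine and_congr ?_ (imp_congr_right fun _ => ?_)
    · rw [← sub_nonpos, e1, sub_nonpos]
    · rw [← sub_neg, e1, sub_neg]
  have hUm : Measurable (X j) := by simp only [hX]; fun_prop
  have key := measureReal_inter_Ioc_le_of_monotone hUm hWU hlaw hBmono hBm ha hη h1 (t / σ j)
  rw [hA] at key
  convert key using 3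
  ext x
  simp only [Set.mem_ofPred_eq, ← hA]
  refine and_congr_right fun _ => ?_
  have : (x j - t) / σ j = X j x - t / σ j := by simp only [hX]; ring
  rw [this, Set.mem_Ioc, Set.mem_Ioc, sub_pos, sub_le_iff_le_add']

/-- Anti-concentration of the maximum of a centered Gaussian vector. -/
theorem measureReal_forall_le_add_le {ι : Type*} [Fintype ι] [Nonempty ι] {ν : Measure (ι → ℝ)}
    [IsGaussian ν] (hν : ν[id] = 0) {b : ℝ} (hb : 0 < b) (hvar : ∀ i, b ≤ ∫ x, x i * x i ∂ν)
    (t : ℝ) {ε : ℝ} (hε : 0 ≤ ε) :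
    ν.real {x | ∀ i, x i ≤ t + ε} ≤ ν.real {x | ∀ i, x i ≤ t}
      + 2 * Real.exp 4 * (ε / √b * (√(2 * Real.log (Fintype.card ι)) + 1)) := by
  classical
  set a := √(2 * Real.log (Fintype.card ι)) with hadef
  set η := ε / √b with hηdef
  have ha : 0 ≤ a := Real.sqrt_nonneg _
  have hη : 0 ≤ η := by positivity
  have he4 : 1 ≤ Real.exp 4 := Real.one_le_exp (by norm_num)
  by_cases h1 : η * (a + 1) ≤ 1
  swap
  · have q1 : ν.real {x | ∀ i, x i ≤ t + ε} ≤ 1 := measureReal_le_one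
    have q2 : 0 ≤ ν.real {x | ∀ i, x i ≤ t} := measureReal_nonneg
    nlinarith
  set σ : ι → ℝ := fun i => √(∫ x, x i * x i ∂ν) with hσdef
  have hσ (i) : 0 < σ i := Real.sqrt_pos.2 (hb.trans_le (hvar i))
  have hσ2 (i) : ∫ x, x i * x i ∂ν = σ i ^ 2 := (Real.sq_sqrt (hb.le.trans (hvar i))).symm
  have hσb (i) : √b ≤ σ i := Real.sqrt_le_sqrt (hvar i)
  set e : ι → ℕ := fun i => Fintype.equivFin ι i with hedef
  have he : Function.Injective e := fun i j h => (Fintype.equivFin ι).injective (Fin.ext h)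
  have hsub : {x : ι → ℝ | ∀ i, x i ≤ t + ε} ⊆ {x | ∀ i, x i ≤ t} ∪
      ⋃ j ∈ (Finset.univ : Finset ι),
        {x | x ∈ argmaxEvent σ t e j ∧ (x j - t) / σ j ∈ Set.Ioc 0 η} := by
    intro x hx
    by_cases hxt : ∀ i, x i ≤ t
    · exact Or.inl hxt
    right
    push Not at hxt
    obtain ⟨i, hi⟩ := hxt
    obtain ⟨j, hj⟩ := exists_mem_argmaxEvent σ t e x
    simp only [Finset.mem_univ, Set.iUnion_true, Set.mem_iUnion]
    refine ⟨j, hj, (div_pos (sub_pos.2 hi) (hσ i)).trans_le (hj i).1, ?_⟩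
    calc (x j - t) / σ j ≤ ε / σ j := by
          have := hx j
          exact div_le_div_of_nonneg_right (by linarith) (hσ j).le
      _ ≤ η := div_le_div_of_nonneg_left hε (Real.sqrt_pos.2 hb) (hσb j)
  have hsum : ∑ j, ν.real (argmaxEvent σ t e j) ≤ 1 := by
    have := sum_measureReal_le_measureReal_univ (μ := ν) (s := Finset.univ)
      (t := argmaxEvent σ t e) (fun j _ => measurableSet_argmaxEvent σ t e j)
      (fun j _ k _ hjk => disjoint_argmaxEvent σ t he hjk)
    simpa using this
  have hN : (Fintype.card ι : ℝ) * Real.exp (-a ^ 2 / 2) = 1 := by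
    have hc : (0 : ℝ) < Fintype.card ι := by exact_mod_cast Fintype.card_pos
    have hlog : 0 ≤ Real.log (Fintype.card ι) := Real.log_natCast_nonneg _
    have : -a ^ 2 / 2 = -Real.log (Fintype.card ι) := by
      rw [hadef, Real.sq_sqrt (by positivity)]
      ring
    rw [this, Real.exp_neg, Real.exp_log hc, mul_inv_cancel₀ hc.ne']
  calc ν.real {x | ∀ i, x i ≤ t + ε}
      ≤ ν.real {x | ∀ i, x i ≤ t} + ∑ j,
        ν.real {x | x ∈ argmaxEvent σ t e j ∧ (x j - t) / σ j ∈ Set.Ioc 0 η} := by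
        refine (measureReal_mono hsub).trans ((measureReal_union_le _ _).trans ?_)
        gcongr
        exact measureReal_biUnion_finset_le _ _
    _ ≤ ν.real {x | ∀ i, x i ≤ t} + ∑ j, (Real.exp 4 * (η * (a + 1)) *
          ν.real (argmaxEvent σ t e j) + η * Real.exp (-a ^ 2 / 2)) := by
        gcongr with j
        exact measureReal_argmaxEvent_inter_Ioc_le hν hσ hσ2 t e j ha hη h1
    _ = ν.real {x | ∀ i, x i ≤ t} + (Real.exp 4 * (η * (a + 1)) *
          ∑ j, ν.real (argmaxEvent σ t e j) + η) := by
        rw [Finset.sum_add_distrib, ← Finset.mul_sum, Finset.sum_const, Finset.card_univ,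
          nsmul_eq_mul, mul_left_comm (Fintype.card ι : ℝ), hN, mul_one]
    _ ≤ ν.real {x | ∀ i, x i ≤ t} + (Real.exp 4 * (η * (a + 1)) * 1 + η) := by gcongr
    _ ≤ _ := by nlinarith [mul_nonneg hη ha]

/-- A smoothed one-sided comparison together with anti-concentration controls the distance of the
distribution functions of the maxima. -/
theorem abs_measureReal_forall_le_sub_le_of_pos {c b : ℝ}
    (hcmp : ∀ {ι : Type} [Fintype ι] [Nonempty ι] {μ ν : Measure (ι → ℝ)} [IsGaussian μ]
      [IsGaussian ν] (_ : μ[id] = 0) (_ : ν[id] = 0) {Δ : ℝ} (_ : 0 ≤ Δ)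
      (_ : ∀ i j, |∫ x, x i * x j ∂μ - ∫ x, x i * x j ∂ν| ≤ Δ)
      (_ : 1 ≤ Real.log (Fintype.card ι)) (t : ℝ) {ε : ℝ} (_ : 0 < ε),
      μ.real {x | ∀ i, x i ≤ t} ≤ ν.real {x | ∀ i, x i ≤ t + ε}
        + c * Δ * Real.log (Fintype.card ι) / ε ^ 2)
    (hb : 0 < b) {ι : Type} [Fintype ι] [Nonempty ι] {μ ν : Measure (ι → ℝ)} [IsGaussian μ]
    [IsGaussian ν] (hμ : μ[id] = 0) (hν : ν[id] = 0) {Δ : ℝ} (hΔ0 : 0 ≤ Δ)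
    (hΔ : ∀ i j, |∫ x, x i * x j ∂μ - ∫ x, x i * x j ∂ν| ≤ Δ)
    (hvar : ∀ i, b ≤ ∫ x, x i * x i ∂ν)
    (hl : 1 ≤ Real.log (Fintype.card ι)) (t : ℝ) {ε : ℝ} (hε : 0 < ε) :
    |μ.real {x | ∀ i, x i ≤ t} - ν.real {x | ∀ i, x i ≤ t}|
      ≤ c * Δ * Real.log (Fintype.card ι) / ε ^ 2
        + 6 * Real.exp 4 / √b * (ε * √(Real.log (Fintype.card ι))) := by
  set l := Real.log (Fintype.card ι)
  have hs : √(2 * l) + 1 ≤ 3 * √l := by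
    have h1 : 1 ≤ √l := Real.one_le_sqrt.2 hl
    have h2 : √(2 * l) ≤ 2 * √l := by
      rw [Real.sqrt_le_left (by positivity), mul_pow, Real.sq_sqrt (by linarith)]
      linarith
    linarith
  have anti (s : ℝ) : ν.real {x | ∀ i, x i ≤ s + ε} ≤ ν.real {x | ∀ i, x i ≤ s}
      + 6 * Real.exp 4 / √b * (ε * √l) := by
    have h1 : 2 * Real.exp 4 * (ε / √b * (√(2 * l) + 1))
        ≤ 6 * Real.exp 4 / √b * (ε * √l) := by
      calc _ ≤ 2 * Real.exp 4 * (ε / √b * (3 * √l)) := by gcongr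
        _ = _ := by ring
    exact (measureReal_forall_le_add_le hν hb hvar s hε.le).trans (by gcongr)
  have up := hcmp hμ hν hΔ0 hΔ hl t hε
  have lo := hcmp hν hμ hΔ0 (fun i j => by rw [abs_sub_comm]; exact hΔ i j) hl (t - ε) hε
  have a1 := anti t
  have a2 := anti (t - ε)
  rw [sub_add_cancel] at lo a2
  rw [abs_le]
  constructor <;> linarith

/-- Comparison of the maxima of two centered Gaussian vectors whose covariances are `Δ`-close. -/
theorem exists_abs_measureReal_forall_le_sub_le {b : ℝ} (hb : 0 < b) : ∃ C : ℝ, 0 < C ∧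
    ∀ {ι : Type} [Fintype ι] [Nonempty ι] {μ ν : Measure (ι → ℝ)} [IsGaussian μ] [IsGaussian ν]
      (_ : μ[id] = 0) (_ : ν[id] = 0) {Δ : ℝ} (_ : 0 ≤ Δ)
      (_ : ∀ i j, |∫ x, x i * x j ∂μ - ∫ x, x i * x j ∂ν| ≤ Δ)
      (_ : ∀ i, b ≤ ∫ x, x i * x i ∂ν) (_ : 1 ≤ Real.log (Fintype.card ι)) (t : ℝ),
      |μ.real {x | ∀ i, x i ≤ t} - ν.real {x | ∀ i, x i ≤ t}|
        ≤ C * (Δ ^ ((1 : ℝ) / 3) * Real.log (Fintype.card ι) ^ ((2 : ℝ) / 3)) := by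
  obtain ⟨c, hc, hcmp⟩ := exists_measureReal_forall_le_le_add
  refine ⟨c + 6 * Real.exp 4 / √b, by positivity, ?_⟩
  intro ι _ _ μ ν _ _ hμ hν Δ hΔ0 hΔ hvar hl t
  have key := fun {ε : ℝ} (hε : 0 < ε) =>
    abs_measureReal_forall_le_sub_le_of_pos hcmp hb hμ hν hΔ0 hΔ hvar hl t hε
  set l := Real.log (Fintype.card ι)
  have hl0 : 0 < l := by linarith
  rcases hΔ0.eq_or_lt with rfl | hΔpos
  · rw [Real.zero_rpow (by norm_num), zero_mul, mul_zero]
    refine le_of_forall_pos_le_add fun δ hδ => ?_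
    refine (key (ε := δ / (6 * Real.exp 4 / √b * √l)) (by positivity)).trans_eq ?_
    field_simp
    ring
  · have e1 : Δ / (Δ ^ ((1 : ℝ) / 3)) ^ 2 = Δ ^ ((1 : ℝ) / 3) := by
      rw [← Real.rpow_natCast, ← Real.rpow_mul hΔ0]
      nth_rewrite 1 [← Real.rpow_one Δ]
      rw [← Real.rpow_sub hΔpos]
      norm_num
    have e2 : l / (l ^ ((1 : ℝ) / 6)) ^ 2 = l ^ ((2 : ℝ) / 3) := by
      rw [← Real.rpow_natCast, ← Real.rpow_mul hl0.le]
      nth_rewrite 1 [← Real.rpow_one l]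
      rw [← Real.rpow_sub hl0]
      norm_num
    have e3 : l ^ ((1 : ℝ) / 6) * √l = l ^ ((2 : ℝ) / 3) := by
      rw [Real.sqrt_eq_rpow, ← Real.rpow_add hl0]
      norm_num
    refine (key (ε := Δ ^ ((1 : ℝ) / 3) * l ^ ((1 : ℝ) / 6)) (by positivity)).trans_eq ?_
    rw [mul_assoc (Δ ^ ((1 : ℝ) / 3)), e3, mul_pow, mul_assoc c, mul_div_assoc,
      mul_div_mul_comm, e1, e2]
    ring

theorem IsCenteredGaussian.integral_eq_zero {Ω : Type*} [MeasurableSpace Ω] {P : Measure Ω}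
    {p : ℕ} {Y : Ω → Fin p → ℝ} {S : Matrix (Fin p) (Fin p) ℝ} (h : IsCenteredGaussian P Y S)
    (a : Fin p → ℝ) : ∫ ω, ∑ j, a j * Y ω j ∂P = 0 := by
  have hY := h.1
  have hm : Measurable fun ω => ∑ j, a j * Y ω j := by fun_prop
  have := integral_map (μ := P) hm.aemeasurable (f := fun x : ℝ => x) (by fun_prop)
  rw [← this, h.2 a, integral_id_gaussianReal]

theorem IsCenteredGaussian.integral_sq {Ω : Type*} [MeasurableSpace Ω] {P : Measure Ω}
    {p : ℕ} {Y : Ω → Fin p → ℝ} {S : Matrix (Fin p) (Fin p) ℝ} (h : IsCenteredGaussian P Y S)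
    (a : Fin p → ℝ) :
    ∫ ω, (∑ j, a j * Y ω j) ^ 2 ∂P = max (∑ j, ∑ l, a j * S j l * a l) 0 := by
  have hY := h.1
  have hm : Measurable fun ω => ∑ j, a j * Y ω j := by fun_prop
  have := integral_map (μ := P) hm.aemeasurable (f := fun x : ℝ => x ^ 2) (by fun_prop)
  rw [← this, h.2 a, ← Real.coe_toNNReal', ← variance_fun_id_gaussianReal (μ := 0),
    variance_of_integral_eq_zero (by fun_prop) integral_id_gaussianReal]

theorem IsCenteredGaussian.hasGaussianLaw {Ω : Type*} [MeasurableSpace Ω] {P : Measure Ω}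
    {p : ℕ} {Y : Ω → Fin p → ℝ} {S : Matrix (Fin p) (Fin p) ℝ} (h : IsCenteredGaussian P Y S) :
    HasGaussianLaw Y P := by
  refine ⟨isGaussian_of_map_eq_gaussianReal fun L => ?_⟩
  refine ⟨0, (∑ j, ∑ l, L (Pi.single j 1) * S j l * L (Pi.single l 1)).toNNReal, ?_⟩
  rw [Measure.map_map (by fun_prop) h.1, ← h.2 fun j => L (Pi.single j 1)]
  congr 1
  ext ω
  simp only [Function.comp_apply]
  conv_lhs => rw [← Finset.univ_sum_single (Y ω), map_sum]
  refine Finset.sum_congr rfl fun j _ => ?_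
  have : Pi.single j (Y ω j) = Y ω j • (Pi.single j 1 : Fin p → ℝ) := by
    rw [← Pi.single_smul, smul_eq_mul, mul_one]
  rw [this, map_smul, smul_eq_mul, mul_comm]

theorem IsCenteredGaussian.memLp {Ω : Type*} [MeasurableSpace Ω] {P : Measure Ω}
    {p : ℕ} {Y : Ω → Fin p → ℝ} {S : Matrix (Fin p) (Fin p) ℝ} (h : IsCenteredGaussian P Y S)
    (j : Fin p) : MemLp (fun ω => Y ω j) 2 P :=
  (h.hasGaussianLaw.map (ContinuousLinearMap.proj (R := ℝ) (φ := fun _ : Fin p => ℝ) j)).memLp_two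

theorem IsCenteredGaussian.integral_apply_sq {Ω : Type*} [MeasurableSpace Ω] {P : Measure Ω}
    {p : ℕ} {Y : Ω → Fin p → ℝ} {S : Matrix (Fin p) (Fin p) ℝ} (h : IsCenteredGaussian P Y S)
    {j : Fin p} (hj : 0 < S j j) : ∫ ω, Y ω j * Y ω j ∂P = S j j := by
  have := h.integral_sq (Pi.single j 1)
  simpa [Pi.single_apply, hj.le, sq] using this

/-- The covariances of a centered Gaussian vector are the entries of the symmetrization of the
matrix `S`, provided that the diagonal of `S` is positive. -/
theorem IsCenteredGaussian.integral_mul {Ω : Type*} [MeasurableSpace Ω] {P : Measure Ω}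
    {p : ℕ} {Y : Ω → Fin p → ℝ} {S : Matrix (Fin p) (Fin p) ℝ} (h : IsCenteredGaussian P Y S)
    (hS : ∀ j, 0 < S j j) (j l : Fin p) :
    ∫ ω, Y ω j * Y ω l ∂P = (S j l + S l j) / 2 := by
  obtain ⟨s, hs, hs2⟩ : ∃ s : ℝ, s ^ 2 = 1 ∧ 0 ≤ s * (S j l + S l j) := by
    rcases le_total 0 (S j l + S l j) with h0 | h0
    · exact ⟨1, by norm_num, by linarith⟩
    · exact ⟨-1, by norm_num, by linarith⟩
  have hint (j l) : Integrable (fun ω => Y ω j * Y ω l) P := (h.memLp j).integrable_mul (h.memLp l)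
  have key := h.integral_sq (Pi.single j 1 + s • Pi.single l 1)
  have e1 : ∀ ω, (∑ k, (Pi.single j 1 + s • Pi.single l 1 : Fin p → ℝ) k * Y ω k) ^ 2
      = Y ω j * Y ω j + (2 * s) * (Y ω j * Y ω l) + Y ω l * Y ω l := by
    intro ω
    have : ∑ k, (Pi.single j 1 + s • Pi.single l 1 : Fin p → ℝ) k * Y ω k
        = Y ω j + s * Y ω l := by
      simp [Pi.single_apply, add_mul, Finset.sum_add_distrib]
    rw [this]
    linear_combination (Y ω l * Y ω l) * hs
  have e2 : ∑ k, ∑ m, (Pi.single j 1 + s • Pi.single l 1 : Fin p → ℝ) k * S k m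
        * (Pi.single j 1 + s • Pi.single l 1 : Fin p → ℝ) m
      = S j j + s * (S j l + S l j) + S l l := by
    have : ∑ k, ∑ m, (Pi.single j 1 + s • Pi.single l 1 : Fin p → ℝ) k * S k m
        * (Pi.single j 1 + s • Pi.single l 1 : Fin p → ℝ) m
      = S j j + S j l * s + (s * S l j + s * S l l * s) := by
      simp [Pi.single_apply, add_mul, mul_add, Finset.sum_add_distrib]
      ring
    rw [this]
    linear_combination S l l * hs
  simp only [e1, e2] at key
  have hadd : Integrable (fun ω => Y ω j * Y ω j + (2 * s) * (Y ω j * Y ω l)) P :=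
    (hint j j).add ((hint j l).const_mul _)
  rw [integral_add hadd (hint l l),
    integral_add (hint j j) ((hint j l).const_mul _), integral_const_mul,
    h.integral_apply_sq (hS j), h.integral_apply_sq (hS l),
    max_eq_left (by linarith [hS j, hS l])] at key
  have key2 : s * (2 * ∫ ω, Y ω j * Y ω l ∂P) = s * (S j l + S l j) := by linarith
  have hs0 : s ≠ 0 := by
    rintro rfl
    norm_num at hs
  linarith [mul_left_cancel₀ hs0 key2]

/-- The vector `(Y, -Y)`. -/
def signedVector {p : ℕ} (y : Fin p → ℝ) (i : Fin p × Bool) : ℝ := (bif i.2 then 1 else -1) * y i.1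

theorem measurable_signedVector {p : ℕ} : Measurable (signedVector (p := p)) :=
  measurable_pi_iff.2 fun i => by
    simp only [signedVector]
    fun_prop

theorem norm_le_iff_signedVector_le {p : ℕ} [NeZero p] (y : Fin p → ℝ) (t : ℝ) :
    ‖y‖ ≤ t ↔ ∀ i, signedVector y i ≤ t := by
  rw [pi_norm_le_iff_of_nonempty]
  simp only [Real.norm_eq_abs, abs_le, signedVector, Prod.forall, Bool.forall_bool, cond_true,
    cond_false]
  refine forall_congr' fun j => ?_
  constructor <;> rintro ⟨h1, h2⟩ <;> constructor <;> linarith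

theorem IsCenteredGaussian.isGaussian_map_signedVector {Ω : Type*} [MeasurableSpace Ω]
    {P : Measure Ω} {p : ℕ} {Y : Ω → Fin p → ℝ} {S : Matrix (Fin p) (Fin p) ℝ}
    (h : IsCenteredGaussian P Y S) : IsGaussian (P.map fun ω => signedVector (Y ω)) :=
  (h.hasGaussianLaw.map (ContinuousLinearMap.pi fun i : Fin p × Bool =>
    (bif i.2 then 1 else -1 : ℝ) •
      ContinuousLinearMap.proj (R := ℝ) (φ := fun _ : Fin p => ℝ) i.1)).isGaussian_map

theorem IsCenteredGaussian.integral_id_map_signedVector {Ω : Type*} [MeasurableSpace Ω]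
    {P : Measure Ω} {p : ℕ} {Y : Ω → Fin p → ℝ} {S : Matrix (Fin p) (Fin p) ℝ}
    (h : IsCenteredGaussian P Y S) : (P.map fun ω => signedVector (Y ω))[id] = 0 := by
  have := h.isGaussian_map_signedVector
  have hm : Measurable fun ω => signedVector (Y ω) := measurable_signedVector.comp h.1
  ext i
  have e := ContinuousLinearMap.integral_comp_comm
    (ContinuousLinearMap.proj (R := ℝ) (φ := fun _ : Fin p × Bool => ℝ) i)
    (IsGaussian.hasGaussianLaw_id (μ := P.map fun ω => signedVector (Y ω))).integrable
  refine e.symm.trans ?_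
  have h1 := h.integral_eq_zero (Pi.single i.1 1)
  simp only [Pi.single_apply, ite_mul, one_mul, zero_mul, Finset.sum_ite_eq', Finset.mem_univ,
    if_true] at h1
  rw [integral_map hm.aemeasurable (by fun_prop)]
  simp [signedVector, integral_const_mul, h1]

theorem integral_mul_map_signedVector {Ω : Type*} [MeasurableSpace Ω]
    {P : Measure Ω} {p : ℕ} {Y : Ω → Fin p → ℝ} (hY : Measurable Y) (i k : Fin p × Bool) :
    ∫ x, x i * x k ∂(P.map fun ω => signedVector (Y ω))
      = ((bif i.2 then 1 else -1) * (bif k.2 then 1 else -1)) * ∫ ω, Y ω i.1 * Y ω k.1 ∂P := by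
  have hm : Measurable fun ω => signedVector (Y ω) := measurable_signedVector.comp hY
  rw [integral_map hm.aemeasurable (by fun_prop), ← integral_const_mul]
  simp only [signedVector]
  congr 1
  ext ω
  ring

theorem toReal_norm_le_eq_map_signedVector {Ω : Type*} [MeasurableSpace Ω]
    {P : Measure Ω} {p : ℕ} [NeZero p] {Y : Ω → Fin p → ℝ} (hY : Measurable Y) (t : ℝ) :
    (P {ω | ‖Y ω‖ ≤ t}).toReal
      = (P.map fun ω => signedVector (Y ω)).real {x | ∀ i, x i ≤ t} := by
  have hm : Measurable fun ω => signedVector (Y ω) := measurable_signedVector.comp hY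
  have hA : MeasurableSet {x : Fin p × Bool → ℝ | ∀ i, x i ≤ t} := by
    rw [Set.ofPred_forall]
    exact MeasurableSet.iInter fun i => measurableSet_le (by fun_prop) (by fun_prop)
  rw [map_measureReal_apply hm hA, measureReal_def]
  congr 2
  ext ω
  exact norm_le_iff_signedVector_le (Y ω) t

theorem abs_bif_mul_bif (r s : Bool) (x : ℝ) :
    |((bif r then 1 else -1) * (bif s then 1 else -1)) * x| = |x| := by
  cases r <;> cases s <;> simp

/-- Gaussian comparison inequality. For centered Gaussian vectors `Y_κ, Y`
in `ℝ^p` (`p ≥ 2`) with covariance matrices `S₁, S₂` satisfying `min_j E Y_j² ≥ b > 0`, and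
`Δ = max_{j,l} |S₁_{jl} - S₂_{jl}|`, there is a constant `C` depending only on `b` with
`sup_t |P(|Y_κ|_∞ ≤ t) - P(|Y|_∞ ≤ t)| ≤ C Δ^(1/3) (1 ∨ log(p/Δ))^(2/3)`.
Here `‖·‖` on `Fin p → ℝ` is the sup norm `|·|_∞`. -/
theorem gaussian_comparison (b : ℝ) (hb : 0 < b) :
    ∃ C : ℝ, 0 < C ∧
      ∀ (p : ℕ), 2 ≤ p →
      ∀ (Ω : Type*) [MeasurableSpace Ω] (P : Measure Ω) [IsProbabilityMeasure P]
        (Yk Y : Ω → Fin p → ℝ) (S₁ S₂ : Matrix (Fin p) (Fin p) ℝ),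
        IsCenteredGaussian P Yk S₁ →
        IsCenteredGaussian P Y S₂ →
        (∀ j, b ≤ S₂ j j) →
        ∀ Δ : ℝ, Δ = ⨆ j, ⨆ l, |S₁ j l - S₂ j l| →
          (⨆ t : ℝ, |(P {ω | ‖Yk ω‖ ≤ t}).toReal - (P {ω | ‖Y ω‖ ≤ t}).toReal|)
            ≤ C * Δ ^ ((1 : ℝ) / 3) * (1 ⊔ Real.log (p / Δ)) ^ ((2 : ℝ) / 3) := by
  obtain ⟨C₀, hC₀, hmain⟩ := exists_abs_measureReal_forall_le_sub_le hb
  have hm0 : 0 < min b 1 := lt_min hb one_pos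
  refine ⟨2 * C₀ + ((min b 1) ^ ((1 : ℝ) / 3))⁻¹, by positivity, ?_⟩
  intro p hp Ω _ P _ Yk Y S₁ S₂ h₁ h₂ hS₂ Δ hΔ
  have : NeZero p := ⟨by omega⟩
  have hentry (j l) : |S₁ j l - S₂ j l| ≤ Δ := by
    rw [hΔ]
    exact (le_ciSup (f := fun l => |S₁ j l - S₂ j l|) (Set.finite_range _).bddAbove l).trans
      (le_ciSup (f := fun j => ⨆ l, |S₁ j l - S₂ j l|) (Set.finite_range _).bddAbove j)
  have hΔ0 : 0 ≤ Δ := (abs_nonneg _).trans (hentry 0 0)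
  have hlog1 : 1 ≤ (1 ⊔ Real.log (p / Δ)) ^ ((2 : ℝ) / 3) :=
    Real.one_le_rpow le_sup_left (by norm_num)
  have hΔ3 : 0 ≤ Δ ^ ((1 : ℝ) / 3) := Real.rpow_nonneg hΔ0 _
  refine ciSup_le fun t => ?_
  rcases le_or_gt (min b 1) Δ with hbig | hsmall
  · have hle : |(P {ω | ‖Yk ω‖ ≤ t}).toReal - (P {ω | ‖Y ω‖ ≤ t}).toReal| ≤ 1 := by
      have q (s : Set Ω) : 0 ≤ (P s).toReal ∧ (P s).toReal ≤ 1 :=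
        ⟨ENNReal.toReal_nonneg, measureReal_le_one⟩
      rw [abs_le]
      constructor <;> linarith [q {ω | ‖Yk ω‖ ≤ t}, q {ω | ‖Y ω‖ ≤ t}]
    have h3 : 1 ≤ ((min b 1) ^ ((1 : ℝ) / 3))⁻¹ * Δ ^ ((1 : ℝ) / 3) := by
      rw [inv_mul_eq_div, one_le_div (by positivity)]
      exact Real.rpow_le_rpow hm0.le hbig (by norm_num)
    calc _ ≤ (1 : ℝ) := hle
      _ ≤ ((min b 1) ^ ((1 : ℝ) / 3))⁻¹ * Δ ^ ((1 : ℝ) / 3) := h3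
      _ ≤ (2 * C₀ + ((min b 1) ^ ((1 : ℝ) / 3))⁻¹) * Δ ^ ((1 : ℝ) / 3) := by
        gcongr
        linarith
      _ ≤ _ := le_mul_of_one_le_right (by positivity) hlog1
  · have hS₂pos (j) : 0 < S₂ j j := hb.trans_le (hS₂ j)
    have hS₁pos (j) : 0 < S₁ j j := by
      linarith [(abs_le.1 (hentry j j)).1, hS₂ j, hsmall.trans_le (min_le_left b 1)]
    have := h₁.isGaussian_map_signedVector
    have := h₂.isGaussian_map_signedVector
    have hp2 : (2 : ℝ) ≤ p := by exact_mod_cast hp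
    have hcard : (Fintype.card (Fin p × Bool) : ℝ) = p * 2 := by simp
    have hlogN : 1 ≤ Real.log (Fintype.card (Fin p × Bool)) := by
      rw [hcard, Real.le_log_iff_exp_le (by linarith)]
      linarith [Real.exp_one_lt_d9]
    have key := hmain h₁.integral_id_map_signedVector h₂.integral_id_map_signedVector hΔ0
      (fun i k => by
        rw [integral_mul_map_signedVector h₁.1, integral_mul_map_signedVector h₂.1, ← mul_sub,
          abs_bif_mul_bif, h₁.integral_mul hS₁pos, h₂.integral_mul hS₂pos]
        have e1 := abs_le.1 (hentry i.1 k.1)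
        have e2 := abs_le.1 (hentry k.1 i.1)
        rw [abs_le]
        constructor <;> linarith)
      (fun i => by
        rw [integral_mul_map_signedVector h₂.1, h₂.integral_apply_sq (hS₂pos i.1)]
        cases i.2 <;> simpa using hS₂ i.1) hlogN t
    rw [← toReal_norm_le_eq_map_signedVector h₁.1, ← toReal_norm_le_eq_map_signedVector h₂.1]
      at key
    refine key.trans ?_
    rcases hΔ0.eq_or_lt with rfl | hΔpos
    · simp
    have hΔ1 : Δ ≤ 1 := (hsmall.trans_le (min_le_right b 1)).le
    have hlog : Real.log (Fintype.card (Fin p × Bool)) ≤ 2 * (1 ⊔ Real.log (p / Δ)) := by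
      rw [hcard, Real.log_mul (by linarith) two_ne_zero]
      have e1 : Real.log 2 ≤ Real.log p := Real.log_le_log two_pos hp2
      have e2 : Real.log p ≤ Real.log (p / Δ) :=
        Real.log_le_log (by linarith) (le_div_self (by linarith) hΔpos hΔ1)
      linarith [le_sup_right (a := 1) (b := Real.log (p / Δ))]
    have hpow : Real.log (Fintype.card (Fin p × Bool)) ^ ((2 : ℝ) / 3)
        ≤ 2 * (1 ⊔ Real.log (p / Δ)) ^ ((2 : ℝ) / 3) := by
      have h0 : (0 : ℝ) ≤ 1 ⊔ Real.log (p / Δ) := zero_le_one.trans le_sup_left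
      refine (Real.rpow_le_rpow (by linarith) hlog (by norm_num)).trans ?_
      rw [Real.mul_rpow zero_le_two h0]
      gcongr
      calc (2 : ℝ) ^ ((2 : ℝ) / 3) ≤ 2 ^ (1 : ℝ) :=
            Real.rpow_le_rpow_of_exponent_le one_le_two (by norm_num)
        _ = 2 := Real.rpow_one 2
    have hm3 : 0 ≤ ((min b 1) ^ ((1 : ℝ) / 3))⁻¹ := by positivity
    calc C₀ * (Δ ^ ((1 : ℝ) / 3) * Real.log (Fintype.card (Fin p × Bool)) ^ ((2 : ℝ) / 3))
        ≤ C₀ * (Δ ^ ((1 : ℝ) / 3) * (2 * (1 ⊔ Real.log (p / Δ)) ^ ((2 : ℝ) / 3))) := by gcongr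
      _ = 2 * C₀ * Δ ^ ((1 : ℝ) / 3) * (1 ⊔ Real.log (p / Δ)) ^ ((2 : ℝ) / 3) := by ring
      _ ≤ _ := by
        gcongr
        linarith
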